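/- Let Ω be a bounded open set with smooth boundary whose closure is contained in B, let α ∈ ℝ with n + α - 2 > 0, and let R > sup_{x ∈ Ω} d(x). Then for every φ ∈ C_c^∞(Ω), ∫_Ω d^α |∇φ|² λ^{n-2} dx ≥ ((n + α - 2)/2)² ∫_Ω d^{α-2} φ² λ^n dx + (1/4) ∫_Ω d^{α-2} (log(R/d))^{-2} φ² λ^n dx. (In hyperbolic notation: ∫_Ω d^α |∇_ℍ φ|² dV ≥ ((n+α-2)/2)² ∫_Ω d^{α-2} φ² dV + (1/4) ∫_Ω d^{α-2} φ²/(log(R/d))² dV.) -/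

import Mathlib

open MeasureTheory Bornology

/-- Conformal factor of the Poincaré ball model. -/
noncomputable def lam {n : ℕ} (x : EuclideanSpace ℝ (Fin n)) : ℝ := 2 / (1 - ‖x‖ ^ 2)

/-- Hyperbolic distance to the origin in the Poincaré ball model. -/
noncomputable def dH {n : ℕ} (x : EuclideanSpace ℝ (Fin n)) : ℝ :=
  Real.log ((1 + ‖x‖) / (1 - ‖x‖))

theorem Real.sinh_le_self_mul_cosh {r : ℝ} (hr : 0 ≤ r) : Real.sinh r ≤ r * Real.cosh r := by
  have hmono : MonotoneOn (fun s : ℝ => s * Real.cosh s - Real.sinh s) (Set.Ici 0) := by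
    refine monotoneOn_of_hasDerivWithinAt_nonneg (f' := fun s => s * Real.sinh s)
      (convex_Ici 0) (by fun_prop) (fun s _ => ?_) (fun s hs => ?_)
    · have h := ((hasDerivAt_id s).mul (Real.hasDerivAt_cosh s)).sub (Real.hasDerivAt_sinh s)
      refine (h.congr_deriv ?_).hasDerivWithinAt
      simp
    · have hs' : 0 ≤ s := interior_subset hs
      exact mul_nonneg hs' (Real.sinh_nonneg_iff.2 hs')
  simpa using hmono (Set.mem_Ici.2 le_rfl) (Set.mem_Ici.2 hr) hr

/-- The radial flux generated by the supersolution `r ^ (-c) * log (R / r) ^ (1 / 2)`. -/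
noncomputable def hardyFlux (m : ℕ) (α c R r : ℝ) : ℝ :=
  Real.sinh r ^ m * r ^ (α - 1) * (c + 1 / (2 * Real.log (R / r)))

theorem log_div_pos {R r : ℝ} (hr : 0 < r) (hrR : r < R) : 0 < Real.log (R / r) :=
  Real.log_pos ((one_lt_div hr).2 hrR)

theorem hardyFlux_nonneg (m : ℕ) {α c R r : ℝ} (hc : 0 ≤ c) (hr : 0 < r) (hrR : r < R) :
    0 ≤ hardyFlux m α c R r := by
  have := log_div_pos hr hrR
  have := Real.sinh_nonneg_iff.2 hr.le
  unfold hardyFlux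
  positivity

theorem exists_hasDerivAt_hardyFlux (m : ℕ) {α c R r : ℝ} (hc : 0 ≤ c)
    (hmα : 2 * c = m + α - 1) (hr : 0 < r) (hrR : r < R) :
    ∃ g', HasDerivAt (hardyFlux m α c R) g' r ∧
      Real.sinh r ^ m * r ^ (α - 2) * (2 * c * (c + 1 / (2 * Real.log (R / r))) +
        1 / (2 * Real.log (R / r) ^ 2)) ≤ g' := by
  have hL := log_div_pos hr hrR
  have hR : 0 < R := hr.trans hrR
  have hS := Real.sinh_nonneg_iff.2 hr.le
  have hdL : HasDerivAt (fun s => Real.log (R / s)) (-1 / r) r := by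
    have h := ((hasDerivAt_const r R).div (hasDerivAt_id r) hr.ne').log
      (div_pos hR hr).ne'
    refine h.congr_deriv ?_
    simp
    field_simp
  have hκ : HasDerivAt (fun s => c + 1 / (2 * Real.log (R / s)))
      (1 / (2 * Real.log (R / r) ^ 2 * r)) r := by
    have h := ((hasDerivAt_const r (1 : ℝ)).div (hdL.const_mul 2) (by positivity)).const_add c
    refine h.congr_deriv ?_
    field_simp
    ring
  have hpow : HasDerivAt (fun s : ℝ => s ^ (α - 1)) ((α - 1) * r ^ (α - 2)) r := by
    refine (Real.hasDerivAt_rpow_const (Or.inl hr.ne')).congr_deriv ?_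
    ring_nf
  have h := (((Real.hasDerivAt_sinh r).pow m).mul hpow).mul hκ
  refine ⟨_, h, ?_⟩
  set L := Real.log (R / r)
  have hr1 : r ^ (α - 1) = r ^ (α - 2) * r := by
    rw [← Real.rpow_add_one hr.ne']; ring_nf
  have hkey : m * Real.sinh r ^ m ≤ m * Real.sinh r ^ (m - 1) * Real.cosh r * r := by
    rcases m with _ | k
    · simp
    · have := Real.sinh_le_self_mul_cosh hr.le
      rw [pow_succ, Nat.add_sub_cancel]
      have h2 : (0 : ℝ) ≤ ((k + 1 : ℕ) : ℝ) * Real.sinh r ^ k := by positivity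
      nlinarith [mul_le_mul_of_nonneg_left this h2]
  have hP : 0 ≤ r ^ (α - 2) * (c + 1 / (2 * L)) := by positivity
  have h3 := mul_le_mul_of_nonneg_right hkey hP
  have hα : α - 1 = 2 * c - m := by linarith
  simp only [Pi.mul_apply, Pi.pow_apply]
  rw [hr1, hα]
  have e : Real.sinh r ^ m * (r ^ (α - 2) * r) * (1 / (2 * L ^ 2 * r)) =
      Real.sinh r ^ m * r ^ (α - 2) * (1 / (2 * L ^ 2)) := by
    field_simp
  rw [e]
  linarith

theorem hardy_integrand_le (m : ℕ) {α c r L l t u v N : ℝ}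
    (hr : 0 < r) (hl : 0 < l) (ht : 0 < t) (huN : v ^ 2 ≤ N ^ 2) {Γ Γ' : ℝ}
    (hΓ : Γ = (l * t) ^ m * r ^ (α - 1) * (c + 1 / (2 * L)))
    (hΓ' : (l * t) ^ m * r ^ (α - 2) * (2 * c * (c + 1 / (2 * L)) + 1 / (2 * L ^ 2)) ≤ Γ') :
    -(2 * u * v * Γ + u ^ 2 * (Γ' * l)) ≤
      t ^ m * (r ^ α * N ^ 2 * l ^ (((m + 1 : ℕ) : ℝ) - 2) -
        (c ^ 2 * (r ^ (α - 2) * u ^ 2 * l ^ ((m + 1 : ℕ) : ℝ)) +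
          1 / 4 * (r ^ (α - 2) * (u ^ 2 / L ^ 2) * l ^ ((m + 1 : ℕ) : ℝ)))) := by
  have hr1 : r ^ (α - 1) = r ^ (α - 2) * r := by
    rw [← Real.rpow_add_one hr.ne']; ring_nf
  have hr2 : r ^ α = r ^ (α - 2) * r ^ 2 := by
    rw [← Real.rpow_natCast, ← Real.rpow_add hr]; norm_num
  have hl1 : l ^ (((m + 1 : ℕ) : ℝ) - 2) = l ^ m / l := by
    rw [show (((m + 1 : ℕ) : ℝ) - 2) = (m : ℝ) - 1 by push_cast; ring,
      Real.rpow_sub_one hl.ne', Real.rpow_natCast]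
  have hl2 : l ^ ((m + 1 : ℕ) : ℝ) = l ^ m * l := by
    rw [Real.rpow_natCast, pow_succ]
  rw [hl1, hl2, hr2, hΓ, hr1]
  set P := (l * t) ^ m * r ^ (α - 2) with hPdef
  have hP : 0 ≤ P := by positivity
  set q := 1 / L with hq
  have e1 : 1 / (2 * L) = q / 2 := by rw [hq]; ring
  have e2 : 1 / (2 * L ^ 2) = q ^ 2 / 2 := by rw [hq]; ring
  have e3 : u ^ 2 / L ^ 2 = u ^ 2 * q ^ 2 := by rw [hq]; ring
  rw [e1, e2] at hΓ'
  rw [e1, e3]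
  have h1 : P * (2 * c * (c + q / 2) + q ^ 2 / 2) * (u ^ 2 * l) ≤ Γ' * (u ^ 2 * l) :=
    mul_le_mul_of_nonneg_right hΓ' (by positivity)
  have h2 : P * (r ^ 2 / l) * v ^ 2 ≤ P * (r ^ 2 / l) * N ^ 2 :=
    mul_le_mul_of_nonneg_left huN (by positivity)
  have h3 : 0 ≤ P / l * (r * v + u * l * (c + q / 2)) ^ 2 := by positivity
  have h4 : P / l * (r * v + u * l * (c + q / 2)) ^ 2 = P * (r ^ 2 / l) * v ^ 2 +
      P * (2 * u * v * r * (c + q / 2)) + P * u ^ 2 * l * (c + q / 2) ^ 2 := by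
    field_simp
    ring
  have h5 : t ^ m * (r ^ (α - 2) * r ^ 2 * N ^ 2 * (l ^ m / l) -
        (c ^ 2 * (r ^ (α - 2) * u ^ 2 * (l ^ m * l)) +
          1 / 4 * (r ^ (α - 2) * (u ^ 2 * q ^ 2) * (l ^ m * l)))) =
      P * (r ^ 2 / l) * N ^ 2 - P * (c ^ 2 + q ^ 2 / 4) * u ^ 2 * l := by
    rw [hPdef, mul_pow]; ring
  have h6 : (l * t) ^ m * (r ^ (α - 2) * r) = P * r := by rw [hPdef]; ring
  rw [h5, h6]
  linarith

theorem setIntegral_Ioi_nonneg_of_deriv_le {D g : ℝ → ℝ}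
    (hg : ∀ t, 0 < t → ∃ g', HasDerivAt g g' t ∧ g' ≤ D t) (hg0 : ∀ t, 0 < t → g t ≤ 0)
    {T : ℝ} (hT : 0 < T) (hgT : g T = 0) (hDT : ∀ t, T < t → D t = 0) :
    0 ≤ ∫ t in Set.Ioi 0, D t := by
  by_cases hD : IntegrableOn D (Set.Ioi 0)
  swap
  · rw [integral_undef hD]
  have hpos : ∀ ε, 0 < ε → ε < T → 0 ≤ ∫ t in Set.Ioi ε, D t := by
    intro ε hε hεT
    have e : ∫ t in Set.Ioi ε, D t = ∫ t in ε..T, D t := by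
      rw [intervalIntegral.integral_of_le hεT.le]
      refine (setIntegral_eq_of_subset_of_forall_sdiff_eq_zero measurableSet_Ioi
        Set.Ioc_subset_Ioi_self fun t ht => hDT t ?_)
      by_contra h
      exact ht.2 ⟨ht.1, not_lt.1 h⟩
    choose! g' hg' using hg
    have h := intervalIntegral.sub_le_integral_of_hasDeriv_right_of_le hεT.le
      (g := g) (g' := g') (φ := D)
      (fun t ht => (hg' t (hε.trans_le ht.1)).1.continuousAt.continuousWithinAt)
      (fun t ht => (hg' t (hε.trans ht.1)).1.hasDerivWithinAt)
      (hD.mono_set fun t ht => hε.trans_le ht.1)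
      (fun t ht => (hg' t (hε.trans ht.1)).2)
    rw [e]
    linarith [hg0 ε hε]
  have hlim := hD.continuousWithinAt_Ici_primitive_Ioi.mono Set.Ioi_subset_Ici_self
  refine ge_of_tendsto (b := (0 : ℝ)) hlim.tendsto ?_
  filter_upwards [Ioo_mem_nhdsGT hT] with ε hε using hpos ε hε.1 hε.2

theorem integral_nonneg_of_forall_ray {E : Type*} [NormedAddCommGroup E] [NormedSpace ℝ E]
    [FiniteDimensional ℝ E] [Nontrivial E] [MeasurableSpace E] [BorelSpace E]
    (μ : Measure E) [μ.IsAddHaarMeasure] {D : E → ℝ}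
    (h : ∀ ω : E, ‖ω‖ = 1 →
      0 ≤ ∫ t in Set.Ioi (0 : ℝ), t ^ (Module.finrank ℝ E - 1) * D (t • ω)) :
    0 ≤ ∫ x, D x ∂μ := by
  by_cases hD : Integrable D μ
  swap
  · rw [integral_undef hD]
  let F : Metric.sphere (0 : E) 1 × Set.Ioi (0 : ℝ) → ℝ := fun p => D (p.2.1 • p.1.1)
  have hF : ∀ x : ({0}ᶜ : Set E), F (homeomorphUnitSphereProd E x) = D x := by
    intro x
    have hx : ‖(x : E)‖ ≠ 0 := norm_ne_zero_iff.2 x.2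
    simp [F, smul_smul, hx]
  have hmp := μ.measurePreserving_homeomorphUnitSphereProd
  have hemb := (homeomorphUnitSphereProd E).measurableEmbedding
  have e1 : ∫ x, D x ∂μ =
      ∫ p, F p ∂μ.toSphere.prod (.volumeIoiPow (Module.finrank ℝ E - 1)) := by
    rw [← hmp.integral_comp hemb F]
    simp only [hF]
    rw [integral_subtype_comap (measurableSet_singleton _).compl fun x => D x,
      restrict_compl_singleton]
  rw [e1]
  by_cases hFi : Integrable F (μ.toSphere.prod (.volumeIoiPow (Module.finrank ℝ E - 1)))
  swap
  · rw [integral_undef hFi]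
  rw [integral_prod _ hFi]
  refine integral_nonneg fun ω => ?_
  refine (h ω.1 (by simp)).trans_eq ?_
  simp only [Measure.volumeIoiPow, ENNReal.ofReal, F]
  rw [integral_withDensity_eq_integral_smul
      (measurable_subtype_coe.pow_const _).real_toNNReal,
    integral_subtype_comap measurableSet_Ioi fun a =>
      Real.toNNReal (a ^ (Module.finrank ℝ E - 1)) • D (a • ω.1)]
  refine setIntegral_congr_fun measurableSet_Ioi fun t ht => ?_
  simp only [NNReal.smul_def, Real.coe_toNNReal _ (pow_nonneg (le_of_lt ht) _), smul_eq_mul]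

theorem dH_nonneg {n : ℕ} {x : EuclideanSpace ℝ (Fin n)} (hx : ‖x‖ < 1) : 0 ≤ dH x :=
  Real.log_nonneg ((one_le_div (by linarith)).2 (by linarith [norm_nonneg x]))

theorem norm_le_dH {n : ℕ} {x : EuclideanSpace ℝ (Fin n)} (hx : ‖x‖ < 1) : ‖x‖ ≤ dH x := by
  have h0 := norm_nonneg x
  have h1 : 0 < 1 - ‖x‖ := by linarith
  refine le_trans ?_ (Real.one_sub_inv_le_log_of_pos (x := (1 + ‖x‖) / (1 - ‖x‖)) (by positivity))
  rw [inv_div, one_sub_div (by positivity), le_div_iff₀ (by positivity)]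
  nlinarith

theorem dH_le {n : ℕ} {x : EuclideanSpace ℝ (Fin n)} {a : ℝ} (ha : a < 1) (hx : ‖x‖ ≤ a) :
    dH x ≤ 2 / (1 - a) * ‖x‖ := by
  have h0 := norm_nonneg x
  have h1 : 0 < 1 - ‖x‖ := by linarith
  have h2 : 0 < 1 - a := by linarith
  refine (Real.log_le_sub_one_of_pos (by positivity)).trans ?_
  rw [div_sub_one h1.ne', div_mul_eq_mul_div, div_le_div_iff₀ h1 h2]
  nlinarith [mul_nonneg h0 (sub_nonneg.2 hx)]

theorem dH_rpow_le {n : ℕ} {x : EuclideanSpace ℝ (Fin n)} {a : ℝ} (ha : a < 1) (hx : ‖x‖ ≤ a)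
    (s : ℝ) : dH x ^ s ≤ (2 / (1 - a)) ^ |s| * ‖x‖ ^ s := by
  have h2 : 0 < 1 - a := by linarith
  have hQ : 1 ≤ 2 / (1 - a) := by
    rw [one_le_div h2]; linarith [norm_nonneg x]
  rcases eq_or_ne x 0 with rfl | hx0
  · have : dH (0 : EuclideanSpace ℝ (Fin n)) = 0 := by simp [dH]
    rw [this, norm_zero]
    exact le_mul_of_one_le_left (Real.rpow_nonneg le_rfl s)
      (Real.one_le_rpow hQ (abs_nonneg s))
  have hpos : 0 < ‖x‖ := norm_pos_iff.2 hx0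
  have hd := norm_le_dH (hx.trans_lt ha)
  have hq : 1 ≤ dH x / ‖x‖ := (one_le_div hpos).2 hd
  have e : dH x = dH x / ‖x‖ * ‖x‖ := by field_simp
  rw [e, Real.mul_rpow (by positivity) hpos.le]
  gcongr
  calc (dH x / ‖x‖) ^ s ≤ (dH x / ‖x‖) ^ |s| :=
        Real.rpow_le_rpow_of_exponent_le hq (le_abs_self s)
    _ ≤ _ := Real.rpow_le_rpow (by positivity) ((div_le_iff₀ hpos).2 (dH_le ha hx))
        (abs_nonneg s)

theorem measurable_dH {n : ℕ} : Measurable (dH : EuclideanSpace ℝ (Fin n) → ℝ) := by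
  unfold dH
  fun_prop

theorem measurable_lam {n : ℕ} : Measurable (lam : EuclideanSpace ℝ (Fin n) → ℝ) := by
  unfold lam
  fun_prop

theorem one_le_lam {n : ℕ} {x : EuclideanSpace ℝ (Fin n)} (hx : ‖x‖ < 1) : 1 ≤ lam x := by
  have h0 := norm_nonneg x
  unfold lam
  rw [one_le_div (by nlinarith)]
  nlinarith

theorem lam_rpow_le {n : ℕ} {x : EuclideanSpace ℝ (Fin n)} {a : ℝ} (ha : a < 1)
    (hx : ‖x‖ ≤ a) (s : ℝ) : lam x ^ s ≤ (2 / (1 - a ^ 2)) ^ |s| := by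
  have h0 := norm_nonneg x
  have h1 := one_le_lam (hx.trans_lt ha)
  refine (Real.rpow_le_rpow_of_exponent_le h1 (le_abs_self s)).trans ?_
  refine Real.rpow_le_rpow (by linarith) ?_ (abs_nonneg s)
  unfold lam
  gcongr
  nlinarith

theorem integrable_dH_rpow_mul {n : ℕ} [NeZero n] {s p a C : ℝ} (hs : 0 < n + s)
    (ha0 : 0 ≤ a) (ha : a < 1) {g : EuclideanSpace ℝ (Fin n) → ℝ} (hg : Measurable g) (hC : ∀ x, |g x| ≤ C)
    (hsupp : ∀ x, a < ‖x‖ → g x = 0) :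
    Integrable (fun x => dH x ^ s * g x * lam x ^ p) := by
  have hball : IntegrableOn (fun x : EuclideanSpace ℝ (Fin n) => ‖x‖ ^ s)
      (Metric.ball 0 1) volume := by
    rw [integrableOn_fun_norm_addHaar volume (f := fun t => t ^ s)]
    have h := (intervalIntegral.integrableOn_Ioo_rpow_iff (s := n - 1 + s) one_pos).2
      (by linarith)
    refine h.congr_fun (fun t ht => ?_) measurableSet_Ioo
    have hn : 1 ≤ n := NeZero.one_le
    simp only [finrank_euclideanSpace, Fintype.card_fin, smul_eq_mul]
    rw [← Real.rpow_natCast, ← Real.rpow_add ht.1, Nat.cast_sub hn, Nat.cast_one]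
  have hmeas : Measurable (fun x => dH x ^ s * g x * lam x ^ p) :=
    ((measurable_dH.pow_const s).mul hg).mul (measurable_lam.pow_const p)
  rw [← integrableOn_iff_integrable_of_support_subset (s := Metric.ball 0 1)]
  · refine (hball.const_mul ((2 / (1 - a)) ^ |s| * C * (2 / (1 - a ^ 2)) ^ |p|)).mono'
      hmeas.aestronglyMeasurable ?_
    refine ae_restrict_of_forall_mem measurableSet_ball fun x hx => ?_
    rw [mem_ball_zero_iff] at hx
    have hd := Real.rpow_nonneg (dH_nonneg hx) s
    have hl := Real.rpow_nonneg (zero_le_one.trans (one_le_lam hx)) p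
    have hn := Real.rpow_nonneg (norm_nonneg x) s
    have hC0 : 0 ≤ C := (abs_nonneg _).trans (hC x)
    rw [norm_mul, norm_mul, Real.norm_of_nonneg hd, Real.norm_of_nonneg hl, Real.norm_eq_abs]
    rcases lt_or_ge a ‖x‖ with h | h
    · rw [hsupp x h, abs_zero, mul_zero, zero_mul]
      have h1 : 0 ≤ 2 / (1 - a) := div_nonneg two_pos.le (by linarith)
      have h2 : 0 ≤ 2 / (1 - a ^ 2) := div_nonneg two_pos.le (by nlinarith)
      positivity
    · have h1 := dH_rpow_le ha h s
      have h2 := lam_rpow_le ha h p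
      calc dH x ^ s * |g x| * lam x ^ p
          ≤ ((2 / (1 - a)) ^ |s| * ‖x‖ ^ s) * C * (2 / (1 - a ^ 2)) ^ |p| := by
            gcongr
            exact hC x
        _ = _ := by ring
  · intro x hx
    rw [mem_ball_zero_iff]
    by_contra h
    refine hx ?_
    simp [hsupp x (ha.trans_le (not_lt.1 h))]

theorem hasDerivAt_log_one_add_div_one_sub {t : ℝ} (h0 : 0 < t) (h1 : t < 1) :
    HasDerivAt (fun t : ℝ => Real.log ((1 + t) / (1 - t))) (2 / (1 - t ^ 2)) t := by
  have h2 : 0 < 1 - t := by linarith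
  have h3 : 0 < 1 + t := by linarith
  have h := (((hasDerivAt_id t).const_add 1).div ((hasDerivAt_id t).const_sub 1) h2.ne').log
    (div_pos h3 h2).ne'
  refine h.congr_deriv ?_
  have : 1 - t ^ 2 = (1 - t) * (1 + t) := by ring
  rw [this]
  simp
  field_simp
  ring

theorem sinh_log_one_add_div_one_sub {t : ℝ} (h0 : 0 < t) (h1 : t < 1) :
    Real.sinh (Real.log ((1 + t) / (1 - t))) = 2 / (1 - t ^ 2) * t := by
  have h2 : 0 < 1 - t := by linarith
  have h3 : 0 < 1 + t := by linarith
  rw [Real.sinh_log (div_pos h3 h2)]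
  have : 1 - t ^ 2 = (1 - t) * (1 + t) := by ring
  rw [this]
  field_simp
  ring

theorem exists_pos_le_log_div_dH {n : ℕ} {K : Set (EuclideanSpace ℝ (Fin n))} (hK : IsCompact K)
    (hK1 : K ⊆ Metric.ball 0 1) {R : ℝ} (hR : ∀ x ∈ K, dH x < R) :
    ∃ δ, 0 < δ ∧ ∀ x ∈ K, x ≠ 0 → δ ≤ Real.log (R / dH x) := by
  rcases K.eq_empty_or_nonempty with rfl | hne
  · exact ⟨1, one_pos, by simp⟩
  have hcont : ContinuousOn dH K := by
    have hlt : ∀ x ∈ K, ‖x‖ < 1 := fun x hx => mem_ball_zero_iff.1 (hK1 hx)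
    unfold dH
    refine ContinuousOn.log (ContinuousOn.div (by fun_prop) (by fun_prop) fun x hx => ?_)
      fun x hx => ?_
    · linarith [hlt x hx]
    · have := hlt x hx
      have := norm_nonneg x
      exact (div_pos (by linarith) (by linarith)).ne'
  obtain ⟨y, hy, hmax⟩ := hK.exists_isMaxOn hne hcont
  have hyR := hR y hy
  have hy0 := dH_nonneg (mem_ball_zero_iff.1 (hK1 hy))
  have hM : 0 < (dH y + R) / 2 := by linarith
  refine ⟨Real.log (R / ((dH y + R) / 2)), log_div_pos hM (by linarith), fun x hx hx0 => ?_⟩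
  have hdx : 0 < dH x :=
    (norm_pos_iff.2 hx0).trans_le (norm_le_dH (mem_ball_zero_iff.1 (hK1 hx)))
  have hle : dH x ≤ dH y := hmax hx
  refine Real.log_le_log (div_pos (by linarith) hM) ?_
  exact div_le_div_of_nonneg_left (by linarith) hdx (by linarith)

theorem gradient_eq_zero_of_notMem_tsupport {n : ℕ} {φ : EuclideanSpace ℝ (Fin n) → ℝ}
    {x : EuclideanSpace ℝ (Fin n)} (hx : x ∉ tsupport φ) : gradient φ x = 0 := by
  have h : fderiv ℝ φ x = 0 := by
    by_contra h
    exact hx (support_fderiv_subset ℝ h)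
  simp [gradient, h]

theorem norm_gradient {n : ℕ} (φ : EuclideanSpace ℝ (Fin n) → ℝ)
    (x : EuclideanSpace ℝ (Fin n)) : ‖gradient φ x‖ = ‖fderiv ℝ φ x‖ :=
  LinearIsometryEquiv.norm_map _ _

theorem hardy_ray {m : ℕ} {α c R : ℝ} (hc : 0 < c) (hmα : 2 * c = m + α - 1)
    {φ : EuclideanSpace ℝ (Fin (m + 1)) → ℝ} (hφ : Differentiable ℝ φ)
    (hφ1 : tsupport φ ⊆ Metric.ball 0 1) (hR : ∀ x ∈ tsupport φ, dH x < R)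
    {ω : EuclideanSpace ℝ (Fin (m + 1))} (hω : ‖ω‖ = 1) :
    0 ≤ ∫ t in Set.Ioi (0 : ℝ), t ^ m *
      (dH (t • ω) ^ α * ‖gradient φ (t • ω)‖ ^ 2 * lam (t • ω) ^ (((m + 1 : ℕ) : ℝ) - 2) -
        (c ^ 2 * (dH (t • ω) ^ (α - 2) * φ (t • ω) ^ 2 * lam (t • ω) ^ ((m + 1 : ℕ) : ℝ)) +
          1 / 4 * (dH (t • ω) ^ (α - 2) * (φ (t • ω) ^ 2 / Real.log (R / dH (t • ω)) ^ 2) *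
            lam (t • ω) ^ ((m + 1 : ℕ) : ℝ)))) := by
  have hnorm : ∀ t : ℝ, 0 < t → ‖t • ω‖ = t := fun t ht => by
    rw [norm_smul, hω, mul_one, Real.norm_of_nonneg ht.le]
  have hdH : ∀ t : ℝ, 0 < t → dH (t • ω) = Real.log ((1 + t) / (1 - t)) := fun t ht => by
    rw [dH, hnorm t ht]
  have hlam : ∀ t : ℝ, 0 < t → lam (t • ω) = 2 / (1 - t ^ 2) := fun t ht => by
    rw [lam, hnorm t ht]
  have hin : ∀ t : ℝ, 0 < t → t • ω ∈ tsupport φ →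
      t < 1 ∧ 0 < dH (t • ω) ∧ dH (t • ω) < R := fun t ht h => by
    have h1 : ‖t • ω‖ < 1 := mem_ball_zero_iff.1 (hφ1 h)
    refine ⟨by rwa [hnorm t ht] at h1, ?_, hR _ h⟩
    exact (ht.trans_eq (hnorm t ht).symm).trans_le (norm_le_dH h1)
  have hout : ∀ t : ℝ, 1 ≤ t → t • ω ∉ tsupport φ := fun t ht h => by
    have := hin t (by linarith) h
    linarith
  refine setIntegral_Ioi_nonneg_of_deriv_le
    (g := fun t => -(φ (t • ω) ^ 2 * hardyFlux m α c R (Real.log ((1 + t) / (1 - t)))))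
    (fun t ht => ?_) (fun t ht => ?_) one_pos ?_ (fun t ht => ?_)
  · by_cases h : t • ω ∈ tsupport φ
    · obtain ⟨ht1, hd0, hdR⟩ := hin t ht h
      rw [hdH t ht] at hd0 hdR ⊢
      rw [hlam t ht]
      obtain ⟨Γ', hΓ, hΓ'⟩ := exists_hasDerivAt_hardyFlux m hc.le hmα hd0 hdR
      have hφt : HasDerivAt (fun t : ℝ => φ (t • ω)) (fderiv ℝ φ (t • ω) ω) t := by
        have h1 : HasDerivAt (fun t : ℝ => t • ω) ω t := by
          simpa using (hasDerivAt_id t).smul_const ω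
        exact (hφ (t • ω)).hasFDerivAt.comp_hasDerivAt t h1
      have hcomp := HasDerivAt.comp t hΓ (hasDerivAt_log_one_add_div_one_sub ht ht1)
      refine ⟨_, ((hφt.pow 2).mul hcomp).neg, ?_⟩
      have hl : 0 < 2 / (1 - t ^ 2) := div_pos two_pos (by nlinarith)
      have hN : fderiv ℝ φ (t • ω) ω ^ 2 ≤ ‖gradient φ (t • ω)‖ ^ 2 := by
        rw [norm_gradient, ← sq_abs]
        refine pow_le_pow_left₀ (abs_nonneg _) ?_ 2
        simpa [hω] using (fderiv ℝ φ (t • ω)).le_opNorm ω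
      have hsinh := sinh_log_one_add_div_one_sub ht ht1
      rw [hsinh] at hΓ'
      refine le_trans (le_of_eq ?_)
        (hardy_integrand_le m (c := c) (u := φ (t • ω)) hd0 hl ht hN
          (Γ := hardyFlux m α c R (Real.log ((1 + t) / (1 - t))))
          (by rw [hardyFlux, hsinh]) hΓ')
      simp
    · have hev : (fun t : ℝ => φ (t • ω)) =ᶠ[nhds t] fun _ => 0 :=
        (by fun_prop : Continuous fun t : ℝ => t • ω).continuousAt.eventually
          (notMem_tsupport_iff_eventuallyEq.1 h)
      refine ⟨0, ?_, ?_⟩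
      · refine (hasDerivAt_const t (0 : ℝ)).congr_of_eventuallyEq ?_
        filter_upwards [hev] with s hs
        simp [hs]
      · simp [image_eq_zero_of_notMem_tsupport h, gradient_eq_zero_of_notMem_tsupport h]
  · by_cases h : t • ω ∈ tsupport φ
    · obtain ⟨ht1, hd0, hdR⟩ := hin t ht h
      rw [hdH t ht] at hd0 hdR
      have := hardyFlux_nonneg m (α := α) hc.le hd0 hdR
      exact neg_nonpos.2 (by positivity)
    · simp [image_eq_zero_of_notMem_tsupport h]
  · simp only [image_eq_zero_of_notMem_tsupport (hout 1 le_rfl)]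
    simp
  · simp [image_eq_zero_of_notMem_tsupport (hout t ht.le),
      gradient_eq_zero_of_notMem_tsupport (hout t ht.le)]

/-- Weighted L² Hardy inequality on ℍⁿ with logarithmic remainder (Corollary 2.1). -/
theorem hardy_hyperbolic_log_remainder {n : ℕ}
    (Ω : Set (EuclideanSpace ℝ (Fin n))) (hΩ_open : IsOpen Ω) (hΩ_bdd : IsBounded Ω)
    (hΩ_sub : closure Ω ⊆ Metric.ball (0 : EuclideanSpace ℝ (Fin n)) 1)
    (α : ℝ) (hα : 0 < (n : ℝ) + α - 2)
    (R : ℝ) (hR : ∀ x ∈ Ω, dH x < R)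
    (φ : EuclideanSpace ℝ (Fin n) → ℝ)
    (hφ_smooth : ContDiff ℝ (⊤ : ℕ∞) φ) (hφ_cpt : HasCompactSupport φ)
    (hφ_supp : tsupport φ ⊆ Ω) :
    (((n : ℝ) + α - 2) / 2) ^ 2 * (∫ x in Ω, dH x ^ (α - 2) * φ x ^ 2 * lam x ^ (n : ℝ)) +
        (1 / 4) * ∫ x in Ω,
          dH x ^ (α - 2) * (φ x ^ 2 / Real.log (R / dH x) ^ 2) * lam x ^ (n : ℝ) ≤
      ∫ x in Ω, dH x ^ α * ‖gradient φ x‖ ^ 2 * lam x ^ ((n : ℝ) - 2) := by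
  rcases n with _ | m
  · have hd : ∀ x : EuclideanSpace ℝ (Fin 0), dH x = 0 := fun x => by
      simp [Subsingleton.elim x 0, dH]
    have hα2 : α - 2 ≠ 0 := by
      push_cast at hα
      linarith
    have hα0 : α ≠ 0 := by
      push_cast at hα
      linarith
    simp [hd, Real.zero_rpow hα2, Real.zero_rpow hα0]
  have hφ1 : tsupport φ ⊆ Metric.ball 0 1 := (hφ_supp.trans subset_closure).trans hΩ_sub
  have hRφ : ∀ x ∈ tsupport φ, dH x < R := fun x hx => hR x (hφ_supp hx)
  obtain ⟨a', ha', hsub⟩ := exists_lt_subset_ball (isClosed_tsupport φ) hφ1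
  obtain ⟨a, ha0, ha1, ha⟩ : ∃ a : ℝ, 0 ≤ a ∧ a < 1 ∧ ∀ x, a < ‖x‖ → x ∉ tsupport φ :=
    ⟨max a' 0, le_max_right _ _, max_lt ha' one_pos, fun x hx h =>
      absurd (mem_ball_zero_iff.1 (hsub h)) (not_lt.2 ((le_max_left _ _).trans hx.le))⟩
  obtain ⟨δ, hδ, hlog⟩ := exists_pos_le_log_div_dH hφ_cpt hφ1 hRφ
  have hφ_diff : Differentiable ℝ φ := hφ_smooth.differentiable (by simp)
  have hgrad_cont : Continuous fun x => ‖gradient φ x‖ ^ 2 := by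
    simp only [norm_gradient]
    exact (hφ_smooth.continuous_fderiv (by simp)).norm.pow 2
  obtain ⟨C₁, hC₁⟩ := hφ_smooth.continuous.bounded_above_of_compact_support hφ_cpt
  obtain ⟨C₂, hC₂⟩ := (hφ_smooth.continuous_fderiv (by simp)).bounded_above_of_compact_support
    (hφ_cpt.fderiv (𝕜 := ℝ))
  have hC₁' : ∀ x, φ x ^ 2 ≤ C₁ ^ 2 := fun x => by
    rw [← sq_abs (φ x)]
    exact pow_le_pow_left₀ (abs_nonneg _) (hC₁ x) 2
  have hfin : Module.finrank ℝ (EuclideanSpace ℝ (Fin (m + 1))) - 1 = m := by simp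
  have hI₁ : Integrable (fun x => dH x ^ α * ‖gradient φ x‖ ^ 2 *
      lam x ^ (((m + 1 : ℕ) : ℝ) - 2)) := by
    refine integrable_dH_rpow_mul (by linarith) ha0 ha1 hgrad_cont.measurable (C := C₂ ^ 2)
      (fun x => ?_) fun x hx => ?_
    · rw [abs_of_nonneg (by positivity), norm_gradient]
      exact pow_le_pow_left₀ (norm_nonneg _) (hC₂ x) 2
    · simp [gradient_eq_zero_of_notMem_tsupport (ha x hx)]
  have hI₂ : Integrable (fun x => dH x ^ (α - 2) * φ x ^ 2 * lam x ^ ((m + 1 : ℕ) : ℝ)) := by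
    refine integrable_dH_rpow_mul (by linarith) ha0 ha1
      (hφ_smooth.continuous.measurable.pow_const 2) (C := C₁ ^ 2) (fun x => ?_) fun x hx => ?_
    · rw [abs_of_nonneg (by positivity)]
      exact hC₁' x
    · simp [image_eq_zero_of_notMem_tsupport (ha x hx)]
  have hI₃ : Integrable (fun x => dH x ^ (α - 2) * (φ x ^ 2 / Real.log (R / dH x) ^ 2) *
      lam x ^ ((m + 1 : ℕ) : ℝ)) := by
    refine integrable_dH_rpow_mul (by linarith) ha0 ha1
      ((hφ_smooth.continuous.measurable.pow_const 2).div
        ((Real.measurable_log.comp (measurable_dH.const_div R)).pow_const 2))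
      (C := C₁ ^ 2 / δ ^ 2) (fun x => ?_) fun x hx => ?_
    · rw [abs_of_nonneg (by positivity)]
      by_cases hx : x ∈ tsupport φ
      · rcases eq_or_ne x 0 with rfl | hx0
        · simp only [dH, norm_zero, add_zero, sub_zero, div_one, Real.log_one, div_zero,
            Real.log_zero]
          norm_num
          positivity
        · have := hlog x hx hx0
          have := hC₁' x
          gcongr
      · rw [image_eq_zero_of_notMem_tsupport hx]
        norm_num
        positivity
    · simp [image_eq_zero_of_notMem_tsupport (ha x hx)]
  have hout : ∀ x, x ∉ Ω → x ∉ tsupport φ := fun x hx h => hx (hφ_supp h)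
  rw [setIntegral_eq_integral_of_forall_compl_eq_zero fun x hx => by
      simp [image_eq_zero_of_notMem_tsupport (hout x hx)],
    setIntegral_eq_integral_of_forall_compl_eq_zero fun x hx => by
      simp [image_eq_zero_of_notMem_tsupport (hout x hx)],
    setIntegral_eq_integral_of_forall_compl_eq_zero fun x hx => by
      simp [gradient_eq_zero_of_notMem_tsupport (hout x hx)],
    ← integral_const_mul, ← integral_const_mul,
    ← integral_add (hI₂.const_mul _) (hI₃.const_mul _), ← sub_nonneg]
  refine (integral_nonneg_of_forall_ray volume fun ω hω => ?_).trans_eq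
    (integral_sub hI₁ ((hI₂.const_mul (((((m + 1 : ℕ) : ℝ) + α - 2) / 2) ^ 2)).add
      (hI₃.const_mul (1 / 4))))
  rw [hfin]
  exact hardy_ray (by linarith) (by push_cast; ring) hφ_diff hφ1 hRφ hω
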